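/- Let A be a unital associative ℂ-algebra and let L(u) = u²·Id + u·G + H (the quadratic evaluation), with G, H n×n matrices with entries in A, satisfy the RLL relation for the fundamental R-matrix. Then the lowered-index entries G_{ab} = Σ_c ε_{ac} G^c_b satisfy the orthogonal/symplectic Lie algebra relations: [G_{ab}, G_{cd}] = −ε_{cb} G_{ad} + ε_{ad} G_{cb} + ε_{ac} G_{bd} − ε_{db} G_{ca} for all a,b,c,d ∈ I. -/

import Mathlib

noncomputable section

/-- The index set `I = {-m,…,-1,(0),1,…,m}` (the value `0` is included iff `zero = true`). -/
def Idx (m : ℤ) (zero : Bool) : Finset ℤ :=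
  if zero then Finset.Icc (-m) m else (Finset.Icc (-m) m).erase 0

/-- The dimension `n` of the fundamental representation: `2m` or `2m+1`. -/
def nDim (m : ℤ) (zero : Bool) : ℤ := if zero then 2 * m + 1 else 2 * m

/-- `β = n/2 - ε`. -/
def betaC (m : ℤ) (zero : Bool) (sgn : ℂ) : ℂ := (nDim m zero : ℂ) / 2 - sgn

/-- The metric `ε_{ab} = ε_a δ_{a,-b}` with `ε_i = 1` for `i ≥ 0`, `ε_{-i} = ε`. -/
def met (sgn : ℂ) (a b : ℤ) : ℂ :=
  if a = -b then (if 0 ≤ a then 1 else sgn) else 0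

/-- The inverse metric `ε^{ab}`, satisfying `Σ_c ε_{ac} ε^{cb} = δ_a^b`. -/
def metUp (sgn : ℂ) (a b : ℤ) : ℂ :=
  if a = -b then (if 0 ≤ b then 1 else sgn) else 0

/-- The fundamental R-matrix
`R(u)^{a₁a₂}_{b₁b₂} = u(u+β) δ^{a₁}_{b₁} δ^{a₂}_{b₂} + (u+β) δ^{a₁}_{b₂} δ^{a₂}_{b₁}
  - ε u ε^{a₁a₂} ε_{b₁b₂}`. -/
def Rmat (m : ℤ) (zero : Bool) (sgn : ℂ) (u : ℂ) (a1 a2 b1 b2 : ℤ) : ℂ :=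
  u * (u + betaC m zero sgn) * (if a1 = b1 then 1 else 0) * (if a2 = b2 then 1 else 0)
    + (u + betaC m zero sgn) * (if a1 = b2 then 1 else 0) * (if a2 = b1 then 1 else 0)
    - sgn * u * metUp sgn a1 a2 * met sgn b1 b2

/-- The RLL relation for a matrix-valued function `L` with entries in a `ℂ`-algebra `A`. -/
def RLL (m : ℤ) (zero : Bool) (sgn : ℂ) {A : Type*} [Ring A] [Algebra ℂ A]
    (L : ℂ → ℤ → ℤ → A) : Prop :=
  ∀ u v : ℂ, ∀ a1 ∈ Idx m zero, ∀ a2 ∈ Idx m zero, ∀ c1 ∈ Idx m zero, ∀ c2 ∈ Idx m zero,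
    (∑ b1 ∈ Idx m zero, ∑ b2 ∈ Idx m zero,
      Rmat m zero sgn (u - v) a1 a2 b1 b2 • (L u b1 c1 * L v b2 c2))
    = ∑ b1 ∈ Idx m zero, ∑ b2 ∈ Idx m zero,
      Rmat m zero sgn (u - v) b1 b2 c1 c2 • (L v a2 b2 * L u a1 b1)

/-- Lowered-index entries `L_{ab}(u) = Σ_c ε_{ac} L^c_b(u)`. -/
def Llow (m : ℤ) (zero : Bool) (sgn : ℂ) {A : Type*} [Ring A] [Algebra ℂ A]
    (L : ℂ → ℤ → ℤ → A) (u : ℂ) (a b : ℤ) : A :=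
  ∑ c ∈ Idx m zero, met sgn a c • L u c b

/-- Lowered-index entries of a single matrix: `M_{ab} = Σ_c ε_{ac} M^c_b`. -/
def lowMat (m : ℤ) (zero : Bool) (sgn : ℂ) {A : Type*} [Ring A] [Algebra ℂ A]
    (M : ℤ → ℤ → A) (a b : ℤ) : A :=
  ∑ c ∈ Idx m zero, met sgn a c • M c b

/-- The entries of `L(u)` are polynomial in the spectral parameter `u`. -/
def IsPolyFam {A : Type*} [Ring A] [Algebra ℂ A] (L : ℂ → ℤ → ℤ → A) : Prop :=
  ∃ (N : ℕ) (coef : ℕ → ℤ → ℤ → A), ∀ (u : ℂ) (a b : ℤ),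
    L u a b = ∑ k ∈ Finset.range (N + 1), u ^ k • coef k a b

/-- The quadratic evaluation `L(u) = u²·Id + u·G + H`. -/
def Lquad {A : Type*} [Ring A] [Algebra ℂ A] (G H : ℤ → ℤ → A) (u : ℂ) (a b : ℤ) : A :=
  (u ^ 2) • (if a = b then (1 : A) else 0) + u • G a b + H a b

section Coefficients

variable {A : Type*} [Ring A] [Algebra ℂ A]

/-- The coefficient of `u ^ 3` of a polynomial function of degree at most `4`. -/
def cubicCoeff {A : Type*} [AddCommGroup A] [Module ℂ A] : (ℂ → A) →ₗ[ℂ] A :=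
  (1 / 12 : ℂ) • (LinearMap.proj 2 - (2 : ℂ) • LinearMap.proj 1
    + (2 : ℂ) • LinearMap.proj (-1) - LinearMap.proj (-2))

/-- The coefficient of `v` of a polynomial function of degree at most `4`. -/
def linearCoeff {A : Type*} [AddCommGroup A] [Module ℂ A] : (ℂ → A) →ₗ[ℂ] A :=
  (1 / 12 : ℂ) • ((8 : ℂ) • LinearMap.proj 1 - (8 : ℂ) • LinearMap.proj (-1)
    - LinearMap.proj 2 + LinearMap.proj (-2))

/-- The coefficient of `u ^ 3 * v` of a polynomial function of degree at most `4` in each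
variable. -/
def cubicLinearCoeff {A : Type*} [AddCommGroup A] [Module ℂ A] : (ℂ → ℂ → A) →ₗ[ℂ] A :=
  cubicCoeff ∘ₗ linearCoeff.compLeft ℂ

theorem cubicLinearCoeff_apply {A : Type*} [AddCommGroup A] [Module ℂ A] (f : ℂ → ℂ → A) :
    cubicLinearCoeff f = cubicCoeff fun u => linearCoeff (f u) := rfl

theorem linearCoeff_quartic {A : Type*} [AddCommGroup A] [Module ℂ A] (c₀ c₁ c₂ c₃ c₄ : A) :
    linearCoeff (fun v : ℂ => c₀ + v • c₁ + v ^ 2 • c₂ + v ^ 3 • c₃ + v ^ 4 • c₄) = c₁ := by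
  simp only [linearCoeff, LinearMap.smul_apply, LinearMap.sub_apply, LinearMap.add_apply,
    LinearMap.proj_apply]
  module

theorem cubicCoeff_quartic {A : Type*} [AddCommGroup A] [Module ℂ A] (c₀ c₁ c₂ c₃ c₄ : A) :
    cubicCoeff (fun u : ℂ => c₀ + u • c₁ + u ^ 2 • c₂ + u ^ 3 • c₃ + u ^ 4 • c₄) = c₃ := by
  simp only [cubicCoeff, LinearMap.smul_apply, LinearMap.sub_apply, LinearMap.add_apply,
    LinearMap.proj_apply]
  module

/-- The coefficient of `u ^ 3 * v` in a quadratic in `u - v` times a biquadratic polynomial. -/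
theorem cubicLinearCoeff_mul {A : Type*} [AddCommGroup A] [Module ℂ A] (i j k : ℂ)
    (c₂₂ c₂₁ c₂₀ c₁₂ c₁₁ c₁₀ c₀₂ c₀₁ c₀₀ : A) :
    cubicLinearCoeff (fun u v : ℂ => (i * (u - v) ^ 2 + j * (u - v) + k) •
      ((u ^ 2 * v ^ 2) • c₂₂ + (u ^ 2 * v) • c₂₁ + u ^ 2 • c₂₀
        + (u * v ^ 2) • c₁₂ + (u * v) • c₁₁ + u • c₁₀ + v ^ 2 • c₀₂ + v • c₀₁ + c₀₀))
      = i • (c₁₁ - (2 : ℂ) • c₂₀) + j • c₂₁ := by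
  have hlin (u : ℂ) : linearCoeff (fun v : ℂ => (i * (u - v) ^ 2 + j * (u - v) + k) •
      ((u ^ 2 * v ^ 2) • c₂₂ + (u ^ 2 * v) • c₂₁ + u ^ 2 • c₂₀
        + (u * v ^ 2) • c₁₂ + (u * v) • c₁₁ + u • c₁₀ + v ^ 2 • c₀₂ + v • c₀₁ + c₀₀))
      = (i * u ^ 2 + j * u + k) • (u ^ 2 • c₂₁ + u • c₁₁ + c₀₁)
        - (2 * i * u + j) • (u ^ 2 • c₂₀ + u • c₁₀ + c₀₀) := by
    rw [← linearCoeff_quartic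
      ((i * u ^ 2 + j * u + k) • (u ^ 2 • c₂₀ + u • c₁₀ + c₀₀))
      ((i * u ^ 2 + j * u + k) • (u ^ 2 • c₂₁ + u • c₁₁ + c₀₁)
        - (2 * i * u + j) • (u ^ 2 • c₂₀ + u • c₁₀ + c₀₀))
      ((i * u ^ 2 + j * u + k) • (u ^ 2 • c₂₂ + u • c₁₂ + c₀₂)
        - (2 * i * u + j) • (u ^ 2 • c₂₁ + u • c₁₁ + c₀₁)
        + i • (u ^ 2 • c₂₀ + u • c₁₀ + c₀₀))
      (-(2 * i * u + j) • (u ^ 2 • c₂₂ + u • c₁₂ + c₀₂)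
        + i • (u ^ 2 • c₂₁ + u • c₁₁ + c₀₁))
      (i • (u ^ 2 • c₂₂ + u • c₁₂ + c₀₂))]
    congr 1
    funext v
    module
  rw [cubicLinearCoeff_apply]
  simp only [hlin]
  rw [← cubicCoeff_quartic (k • c₀₁ - j • c₀₀)
    (k • c₁₁ + j • c₀₁ - j • c₁₀ - (2 * i) • c₀₀)
    (k • c₂₁ + j • c₁₁ + i • c₀₁ - j • c₂₀ - (2 * i) • c₁₀)
    (i • (c₁₁ - (2 : ℂ) • c₂₀) + j • c₂₁) (i • c₂₁)]
  congr 1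
  funext u
  module

/-- The coefficient of `u ^ 3 * v` in one summand of the left-hand side of the RLL relation. -/
theorem cubicLinearCoeff_mul_quadratic (i j k : ℂ) (x y z x' y' z' : A) :
    cubicLinearCoeff (fun u v : ℂ => (i * (u - v) ^ 2 + j * (u - v) + k) •
      ((u ^ 2 • x + u • y + z) * (v ^ 2 • x' + v • y' + z')))
      = i • (y * y' - (2 : ℂ) • (x * z')) + j • (x * y') := by
  rw [← cubicLinearCoeff_mul i j k (x * x') (x * y') (x * z') (y * x') (y * y') (y * z')
    (z * x') (z * y') (z * z')]
  congr 1
  funext u v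
  simp only [add_mul, mul_add, smul_mul_assoc, mul_smul_comm]
  module

/-- The coefficient of `u ^ 3 * v` in one summand of the right-hand side of the RLL relation. -/
theorem cubicLinearCoeff_mul_quadratic_swap (i j k : ℂ) (x y z x' y' z' : A) :
    cubicLinearCoeff (fun u v : ℂ => (i * (u - v) ^ 2 + j * (u - v) + k) •
      ((v ^ 2 • x' + v • y' + z') * (u ^ 2 • x + u • y + z)))
      = i • (y' * y - (2 : ℂ) • (z' * x)) + j • (y' * x) := by
  rw [← cubicLinearCoeff_mul i j k (x' * x) (y' * x) (z' * x) (x' * y) (y' * y) (z' * y)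
    (x' * z) (y' * z) (z' * z)]
  congr 1
  funext u v
  simp only [add_mul, mul_add, smul_mul_assoc, mul_smul_comm]
  module

/-- The coefficient of `w` in the R-matrix `R(w)`. -/
def RmatLinear (m : ℤ) (zero : Bool) (sgn : ℂ) (a1 a2 b1 b2 : ℤ) : ℂ :=
  betaC m zero sgn * (if a1 = b1 then 1 else 0) * (if a2 = b2 then 1 else 0)
    + (if a1 = b2 then 1 else 0) * (if a2 = b1 then 1 else 0)
    - sgn * metUp sgn a1 a2 * met sgn b1 b2

theorem Rmat_eq_quadratic (m : ℤ) (zero : Bool) (sgn w : ℂ) (a1 a2 b1 b2 : ℤ) :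
    Rmat m zero sgn w a1 a2 b1 b2
      = ((if a1 = b1 then 1 else 0) * (if a2 = b2 then 1 else 0)) * w ^ 2
        + RmatLinear m zero sgn a1 a2 b1 b2 * w
        + betaC m zero sgn * (if a1 = b2 then 1 else 0) * (if a2 = b1 then 1 else 0) := by
  unfold Rmat RmatLinear
  ring

theorem neg_mem_Idx {m : ℤ} {zero : Bool} {a : ℤ} (ha : a ∈ Idx m zero) : -a ∈ Idx m zero := by
  unfold Idx at *
  split_ifs at * <;> simp_all <;> lia

theorem lowMat_eq {m : ℤ} {zero : Bool} (sgn : ℂ) (M : ℤ → ℤ → A) {a : ℤ}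
    (ha : a ∈ Idx m zero) (b : ℤ) :
    lowMat m zero sgn M a b = met sgn a (-a) • M (-a) b := by
  rw [lowMat, Finset.sum_eq_single_of_mem (-a) (neg_mem_Idx ha)]
  intro c _ hc
  rw [met, if_neg (by lia), zero_smul]

theorem cubicLinearCoeff_sum {ι : Type*} (s : Finset ι) (f : ι → ℂ → ℂ → A) :
    cubicLinearCoeff (fun u v => ∑ b ∈ s, f b u v) = ∑ b ∈ s, cubicLinearCoeff (f b) := by
  rw [← map_sum]
  congr 1
  funext u v
  simp only [Finset.sum_apply]

/-- The `u ^ 3 * v` coefficient of the RLL relation, as an equality of sums. -/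
theorem RLL.sum_cubicLinearCoeff {m : ℤ} {zero : Bool} {sgn : ℂ} {G H : ℤ → ℤ → A}
    (h : RLL m zero sgn (Lquad G H)) {a1 a2 c1 c2 : ℤ} (ha1 : a1 ∈ Idx m zero)
    (ha2 : a2 ∈ Idx m zero) (hc1 : c1 ∈ Idx m zero) (hc2 : c2 ∈ Idx m zero) :
    ∑ b1 ∈ Idx m zero, ∑ b2 ∈ Idx m zero,
      (((if a1 = b1 then 1 else 0) * (if a2 = b2 then 1 else 0) : ℂ) •
          (G b1 c1 * G b2 c2 - (2 : ℂ) • ((if b1 = c1 then 1 else 0) * H b2 c2))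
        + RmatLinear m zero sgn a1 a2 b1 b2 • ((if b1 = c1 then 1 else 0) * G b2 c2))
    = ∑ b1 ∈ Idx m zero, ∑ b2 ∈ Idx m zero,
      (((if b1 = c1 then 1 else 0) * (if b2 = c2 then 1 else 0) : ℂ) •
          (G a2 b2 * G a1 b1 - (2 : ℂ) • (H a2 b2 * (if a1 = b1 then 1 else 0)))
        + RmatLinear m zero sgn b1 b2 c1 c2 • (G a2 b2 * (if a1 = b1 then 1 else 0))) := by
  have key := congrArg cubicLinearCoeff
    (funext fun u => funext fun v => h u v a1 ha1 a2 ha2 c1 hc1 c2 hc2)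
  simp only [cubicLinearCoeff_sum, Rmat_eq_quadratic, Lquad] at key
  simpa only [cubicLinearCoeff_mul_quadratic, cubicLinearCoeff_mul_quadratic_swap] using key

theorem sum_metUp_smul {m : ℤ} {zero : Bool} (sgn : ℂ) (f : ℤ → A) {a : ℤ}
    (ha : a ∈ Idx m zero) :
    ∑ b ∈ Idx m zero, metUp sgn a b • f b = metUp sgn a (-a) • f (-a) := by
  rw [Finset.sum_eq_single_of_mem (-a) (neg_mem_Idx ha)]
  intro c _ hc
  rw [metUp, if_neg (by lia), zero_smul]

/-- The commutator of the entries of `G`, with upper first indices. -/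
theorem RLL.commutator {m : ℤ} {zero : Bool} {sgn : ℂ} {G H : ℤ → ℤ → A}
    (h : RLL m zero sgn (Lquad G H)) {a1 a2 c1 c2 : ℤ} (ha1 : a1 ∈ Idx m zero)
    (ha2 : a2 ∈ Idx m zero) (hc1 : c1 ∈ Idx m zero) (hc2 : c2 ∈ Idx m zero) :
    G a1 c1 * G a2 c2 - G a2 c2 * G a1 c1
      = -((if a2 = c1 then 1 else 0 : ℂ) • G a1 c2) + (if a1 = c2 then 1 else 0 : ℂ) • G a2 c1
        + (sgn * metUp sgn a1 a2) • lowMat m zero sgn G c1 c2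
        - (sgn * met sgn c1 c2 * metUp sgn a1 (-a1)) • G a2 (-a1) := by
  have key := h.sum_cubicLinearCoeff ha1 ha2 hc1 hc2
  simp only [RmatLinear, smul_sub, sub_smul, add_smul, mul_smul, ite_smul, one_smul,
    zero_smul, ite_mul, mul_ite, one_mul, mul_one, zero_mul, mul_zero, smul_zero, smul_ite,
    Finset.sum_add_distrib, Finset.sum_sub_distrib, Finset.sum_ite_eq, Finset.sum_ite_eq',
    Finset.sum_ite_irrel, Finset.sum_const_zero, ha1, ha2, hc1, hc2, if_true] at key
  have hlow : ∑ x ∈ Idx m zero, sgn • metUp sgn a1 a2 • met sgn c1 x • G x c2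
      = (sgn * metUp sgn a1 a2) • lowMat m zero sgn G c1 c2 := by
    simp only [lowMat, Finset.smul_sum, smul_smul, mul_assoc]
  have hup : ∑ x ∈ Idx m zero, sgn • metUp sgn a1 x • met sgn c1 c2 • G a2 x
      = (sgn * met sgn c1 c2 * metUp sgn a1 (-a1)) • G a2 (-a1) := by
    rw [mul_smul, ← sum_metUp_smul sgn (fun b => G a2 b) ha1, Finset.smul_sum]
    refine Finset.sum_congr rfl fun x _ => ?_
    module
  rw [hlow, hup] at key
  simp only [ite_smul, one_smul, zero_smul]
  linear_combination (norm := module) key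

end Coefficients

theorem met_neg_mul_ite (sgn : ℂ) (a b : ℤ) :
    met sgn a (-a) * (if -a = b then 1 else 0) = met sgn a b := by
  by_cases h : a = -b
  · subst h
    simp [met]
  · rw [if_neg (by lia), mul_zero, met, if_neg h]

theorem met_neg_mul_metUp {sgn : ℂ} (hsgn : sgn = 1 ∨ sgn = -1) (a : ℤ) :
    met sgn a (-a) * metUp sgn (-a) a = 1 := by
  unfold met metUp
  rcases hsgn with rfl | rfl <;> split_ifs <;> simp_all

theorem sgn_mul_met {m : ℤ} {zero : Bool} {sgn : ℂ} (hsgn : sgn = 1 ∨ sgn = -1)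
    (hz : zero = true → sgn = 1) {a : ℤ} (ha : a ∈ Idx m zero) (b : ℤ) :
    sgn * met sgn a b = met sgn b a := by
  by_cases hab : a = -b
  · subst hab
    rcases lt_trichotomy b 0 with hb | rfl | hb
    · simp [met, hb.le, hb.not_ge]
    · have hsgn_one : sgn = 1 := by
        apply hz
        by_contra hzero
        simp [Idx, hzero] at ha
      simp [met, hsgn_one]
    · rcases hsgn with rfl | rfl <;> simp [met, hb.le, hb.not_ge]
  · rw [met, met, if_neg hab, if_neg (by lia), mul_zero]

theorem met_mul_met_mul_metUp {m : ℤ} {zero : Bool} {sgn : ℂ} (hsgn : sgn = 1 ∨ sgn = -1)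
    (hz : zero = true → sgn = 1) {a : ℤ} (ha : a ∈ Idx m zero) (c : ℤ) :
    met sgn a (-a) * met sgn c (-c) * (sgn * metUp sgn (-a) (-c)) = met sgn a c := by
  by_cases hac : c = -a
  · subst hac
    have hinv := met_neg_mul_metUp hsgn a
    have hsymm := sgn_mul_met hsgn hz (neg_mem_Idx ha) a
    simp only [neg_neg] at *
    linear_combination (sgn * met sgn (-a) a) * hinv + hsymm
  · rw [metUp, if_neg (by lia), met, met, met, if_neg (show a ≠ -c by lia), mul_zero, mul_zero]

/-- in the quadratic evaluation, `G` satisfies the orthogonal/symplectic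
Lie algebra relations. -/
theorem stmt3 (m : ℤ) (zero : Bool) (sgn : ℂ) (hm : 1 ≤ m)
    (hsgn : sgn = 1 ∨ sgn = -1) (hz : zero = true → sgn = 1)
    (A : Type*) [Ring A] [Algebra ℂ A]
    (G H : ℤ → ℤ → A)
    (hRLL : RLL m zero sgn (Lquad G H)) :
    ∀ a ∈ Idx m zero, ∀ b ∈ Idx m zero, ∀ c ∈ Idx m zero, ∀ d ∈ Idx m zero,
      lowMat m zero sgn G a b * lowMat m zero sgn G c d
          - lowMat m zero sgn G c d * lowMat m zero sgn G a b
        = -(met sgn c b • lowMat m zero sgn G a d) + met sgn a d • lowMat m zero sgn G c b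
          + met sgn a c • lowMat m zero sgn G b d - met sgn d b • lowMat m zero sgn G c a := by
  intro a ha b hb c hc d hd
  have key := hRLL.commutator (neg_mem_Idx ha) (neg_mem_Idx hc) hb hd
  rw [neg_neg] at key
  rw [lowMat_eq sgn G ha b, lowMat_eq sgn G ha d, lowMat_eq sgn G hc d, lowMat_eq sgn G hc b,
    lowMat_eq sgn G hc a, ← met_neg_mul_ite sgn c b, ← met_neg_mul_ite sgn a d,
    ← met_mul_met_mul_metUp hsgn hz ha c, ← sgn_mul_met hsgn hz hb d]
  have hinv := met_neg_mul_metUp hsgn a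
  simp only [smul_mul_smul_comm]
  linear_combination (norm := module) (met sgn a (-a) * met sgn c (-c)) • key
    - (sgn * met sgn b d * met sgn c (-c)) • congrArg (fun t : ℂ => t • G (-c) a) hinv
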